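/- Let H be a finite-dimensional complex Hilbert space, n ∈ ℕ, α ∈ (0,1), and R ∈ ℝ. For any quantum states ρ, σ on H^{⊗n}, let P be the spectral projection onto the nonnegative eigenspace of ρ − 2^{nR}σ (i.e., P = {2^{nR}σ ≤ ρ}). Then tr[ρ(I − P)] ≤ 2^{n(1−α)R} tr[ρ^α σ^{1−α}] and tr[σ P] ≤ 2^{−nαR} tr[ρ^α σ^{1−α}]. -/

import Mathlib

open Filter Set
open scoped ComplexOrder Classical

noncomputable section

/-- The index type of the `n`-fold tensor power of a `d`-dimensional Hilbert space. -/
abbrev TIdx (d n : ℕ) := Fin n → Fin d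

/-- Operators on the `n`-fold tensor power of a `d`-dimensional complex Hilbert space. -/
abbrev Mat (d n : ℕ) := Matrix (TIdx d n) (TIdx d n) ℂ

/-- A quantum state: positive semidefinite with unit trace. -/
def IsState {d n : ℕ} (ρ : Mat d n) : Prop := ρ.PosSemidef ∧ ρ.trace = 1

/-- Tensor product of an operator on `H^{⊗m}` and one on `H^{⊗n}`, as an operator on
`H^{⊗(m+n)}`. -/
def tensorProd {d m n : ℕ} (A : Mat d m) (B : Mat d n) : Mat d (m + n) :=
  Matrix.of fun f g =>
    A (fun i => f (Fin.castAdd n i)) (fun i => g (Fin.castAdd n i)) *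
      B (fun j => f (Fin.natAdd m j)) (fun j => g (Fin.natAdd m j))

/-- `suppLE ρ σ` means the support of `ρ` is contained in the support of `σ`
(equivalently, `ker σ ⊆ ker ρ` for Hermitian PSD matrices). -/
def suppLE {d n : ℕ} (ρ σ : Mat d n) : Prop :=
  ∀ v : TIdx d n → ℂ, σ.mulVec v = 0 → ρ.mulVec v = 0

/-- Real matrix power via the functional calculus (junk value `0` for non-Hermitian input);
powers are taken on the support since `(0:ℝ) ^ p = 0` for `p ≠ 0`. -/
def mpow {d n : ℕ} (A : Mat d n) (p : ℝ) : Mat d n :=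
  if h : A.IsHermitian then
    (h.eigenvectorUnitary : Mat d n) *
      Matrix.diagonal (fun i => ((h.eigenvalues i ^ p : ℝ) : ℂ)) *
      (star (h.eigenvectorUnitary : Mat d n))
  else 0

/-- Matrix base-2 logarithm via the functional calculus, taken on the support. -/
def mlog {d n : ℕ} (A : Mat d n) : Mat d n :=
  if h : A.IsHermitian then
    (h.eigenvectorUnitary : Mat d n) *
      Matrix.diagonal (fun i => ((Real.logb 2 (h.eigenvalues i) : ℝ) : ℂ)) *
      (star (h.eigenvectorUnitary : Mat d n))
  else 0

/-- The Petz quasi-divergence quantity `tr[ρ^α σ^{1-α}]`. -/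
def qPetz {d n : ℕ} (α : ℝ) (ρ σ : Mat d n) : ℝ :=
  (mpow ρ α * mpow σ (1 - α)).trace.re

/-- The Petz Rényi divergence (base-2), `+∞` unless `supp ρ ⊆ supp σ`. -/
def DPetz {d n : ℕ} (α : ℝ) (ρ σ : Mat d n) : EReal :=
  if suppLE ρ σ then (((α - 1)⁻¹ * Real.logb 2 (qPetz α ρ σ) : ℝ) : EReal) else ⊤

/-- The sandwiched quasi-divergence quantity `tr[(σ^{(1-α)/(2α)} ρ σ^{(1-α)/(2α)})^α]`. -/
def qSand {d n : ℕ} (α : ℝ) (ρ σ : Mat d n) : ℝ :=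
  (mpow (mpow σ ((1 - α) / (2 * α)) * ρ * mpow σ ((1 - α) / (2 * α))) α).trace.re

/-- The sandwiched Rényi divergence (base-2), `+∞` unless `supp ρ ⊆ supp σ`. -/
def DSand {d n : ℕ} (α : ℝ) (ρ σ : Mat d n) : EReal :=
  if suppLE ρ σ then (((α - 1)⁻¹ * Real.logb 2 (qSand α ρ σ) : ℝ) : EReal) else ⊤

/-- The quantum Hoeffding divergence `H_{n,r}(ρ‖σ)`. -/
def Hoeffding {d : ℕ} (n : ℕ) (r : ℝ) (ρ σ : Mat d n) : EReal :=
  ⨆ α ∈ Set.Ioo (0 : ℝ) 1,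
    (((α - 1) / α : ℝ) : EReal) * ((((n : ℝ) * r : ℝ) : EReal) - DPetz α ρ σ)

/-- The quantum Hoeffding anti-divergence `H*_{n,r}(ρ‖σ)`. -/
def HoeffdingA {d : ℕ} (n : ℕ) (r : ℝ) (ρ σ : Mat d n) : EReal :=
  ⨆ α ∈ Set.Ioi (1 : ℝ),
    (((α - 1) / α : ℝ) : EReal) * ((((n : ℝ) * r : ℝ) : EReal) - DSand α ρ σ)

/-- Petz Rényi divergence between two sets of states. -/
def DPetzSet {d n : ℕ} (α : ℝ) (A B : Set (Mat d n)) : EReal :=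
  ⨅ ρ ∈ A, ⨅ σ ∈ B, DPetz α ρ σ

/-- Sandwiched Rényi divergence between two sets of states. -/
def DSandSet {d n : ℕ} (α : ℝ) (A B : Set (Mat d n)) : EReal :=
  ⨅ ρ ∈ A, ⨅ σ ∈ B, DSand α ρ σ

/-- Quantum Hoeffding divergence between two sets of states. -/
def HoeffdingSet {d : ℕ} (n : ℕ) (r : ℝ) (A B : Set (Mat d n)) : EReal :=
  ⨅ ρ ∈ A, ⨅ σ ∈ B, Hoeffding n r ρ σ

/-- Quantum Hoeffding anti-divergence between two sets of states. -/
def HoeffdingASet {d : ℕ} (n : ℕ) (r : ℝ) (A B : Set (Mat d n)) : EReal :=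
  ⨆ ρ ∈ A, ⨆ σ ∈ B, HoeffdingA n r ρ σ

/-- A test (two-outcome POVM element): `0 ≤ M ≤ I`. -/
def IsTest {d n : ℕ} (M : Mat d n) : Prop := M.PosSemidef ∧ (1 - M).PosSemidef

/-- Worst-case type-I error of a test `M` for the set `A`. -/
def typeI {d n : ℕ} (A : Set (Mat d n)) (M : Mat d n) : ℝ :=
  ⨆ ρ ∈ A, (ρ * (1 - M)).trace.re

/-- Worst-case type-II error of a test `M` for the set `B`. -/
def typeII {d n : ℕ} (B : Set (Mat d n)) (M : Mat d n) : ℝ :=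
  ⨆ σ ∈ B, (σ * M).trace.re

/-- Optimal type-I error at type-II error exponent `r`:
`α_{n,r}(A‖B) = inf { α(A,M) : 0 ≤ M ≤ I, β(B,M) ≤ 2^{-nr} }`. -/
def optAlpha {d : ℕ} (n : ℕ) (r : ℝ) (A B : Set (Mat d n)) : ℝ :=
  sInf {x | ∃ M : Mat d n, IsTest M ∧ typeII B M ≤ (2 : ℝ) ^ (-((n : ℝ) * r)) ∧ x = typeI A M}

/-- Optimal type-I error for a single pair of states. -/
def optAlphaPair {d : ℕ} (n : ℕ) (r : ℝ) (ρ σ : Mat d n) : ℝ :=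
  optAlpha n r {ρ} {σ}

/-- `- log₂ x` as an extended real, with `-log₂ 0 = +∞`. -/
def negLog2 (x : ℝ) : EReal := if x = 0 then ⊤ else ((-Real.logb 2 x : ℝ) : EReal)

/-- A sequence of sets of operators is stable under tensor product. -/
def Stable {d : ℕ} (A : ∀ n : ℕ, Set (Mat d n)) : Prop :=
  ∀ m n : ℕ, ∀ X ∈ A m, ∀ Y ∈ A n, tensorProd X Y ∈ A (m + n)

/-- Invariance under conjugation by the unitaries permuting the tensor factors. -/
def PermInvariant {d n : ℕ} (C : Set (Mat d n)) : Prop :=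
  ∀ π : Equiv.Perm (Fin n), ∀ M ∈ C,
    Matrix.of (fun f g : TIdx d n => M (f ∘ π) (g ∘ π)) ∈ C

/-- The polar of a set of positive semidefinite operators. -/
def polar {d n : ℕ} (C : Set (Mat d n)) : Set (Mat d n) :=
  {X | X.PosSemidef ∧ ∀ Y ∈ C, (X * Y).trace.re ≤ 1}

/-- Max-relative entropy between two sets (base-2):
`inf_{ρ∈A,σ∈B} log inf {λ ≥ 0 : ρ ≤ λσ}`. -/
def DmaxSet {d n : ℕ} (A B : Set (Mat d n)) : EReal :=
  ⨅ ρ ∈ A, ⨅ σ ∈ B, ⨅ lam ∈ {l : ℝ | 0 ≤ l ∧ (l • σ - ρ).PosSemidef},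
    ((Real.logb 2 lam : ℝ) : EReal)

/-- Umegaki relative entropy (base-2), `+∞` unless `supp ρ ⊆ supp σ`. -/
def DUm {d n : ℕ} (ρ σ : Mat d n) : EReal :=
  if suppLE ρ σ then (((ρ * (mlog ρ - mlog σ)).trace.re : ℝ) : EReal) else ⊤

/-- Umegaki relative entropy between two sets. -/
def DUmSet {d n : ℕ} (A B : Set (Mat d n)) : EReal :=
  ⨅ ρ ∈ A, ⨅ σ ∈ B, DUm ρ σ

/-- Spectral projection onto the nonnegative eigenspace of a matrix
(junk value `0` for non-Hermitian input). -/
def posProj {d n : ℕ} (X : Mat d n) : Mat d n :=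
  if h : X.IsHermitian then
    (h.eigenvectorUnitary : Mat d n) *
      Matrix.diagonal (fun i => if 0 ≤ h.eigenvalues i then (1 : ℂ) else 0) *
      (star (h.eigenvectorUnitary : Mat d n))
  else 0

section PowerTraceInequality

open scoped MatrixOrder Matrix.Norms.L2Operator

variable {m : Type*} [Fintype m] [DecidableEq m]

lemma Matrix.trace_mul_re_nonneg {X Y : Matrix m m ℂ} (hX : 0 ≤ X) (hY : 0 ≤ Y) :
    0 ≤ (X * Y).trace.re := by
  obtain ⟨S, rfl⟩ := CStarAlgebra.nonneg_iff_eq_star_mul_self.mp hY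
  have h : (X * (star S * S)).trace = (S * X * star S).trace := by
    rw [← mul_assoc, Matrix.trace_mul_comm, ← mul_assoc]
  rw [h]
  exact (Complex.nonneg_iff.mp
    ((Matrix.nonneg_iff_posSemidef.mp hX).mul_mul_conjTranspose_same S).trace_nonneg).1

lemma Matrix.continuousOn_spectrum_real (X : Matrix m m ℂ) (f : ℝ → ℝ) :
    ContinuousOn f (spectrum ℝ X) :=
  (Matrix.finite_real_spectrum (A := X)).continuousOn f

lemma Matrix.rpow_mul_rpow_one_sub {X : Matrix m m ℂ} (hX : 0 ≤ X) {s : ℝ}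
    (hs : s ∈ Ioo (0 : ℝ) 1) : X ^ s * X ^ (1 - s) = X := by
  rw [CFC.rpow_eq_cfc_real hX, CFC.rpow_eq_cfc_real hX,
    ← cfc_mul _ _ X (X.continuousOn_spectrum_real _) (X.continuousOn_spectrum_real _)]
  conv_rhs => rw [← cfc_id ℝ X]
  refine cfc_congr fun x hx => ?_
  have hx0 : 0 ≤ x := spectrum_nonneg_of_nonneg hX hx
  simp only [id]
  rw [← Real.rpow_add' hx0 (by norm_num)]
  norm_num

lemma Matrix.smul_rpow {X : Matrix m m ℂ} (hX : 0 ≤ X) {c : ℝ} (hc : 0 ≤ c) (s : ℝ) :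
    (c • X) ^ s = c ^ s • X ^ s := by
  rw [CFC.rpow_eq_cfc_real (smul_nonneg hc hX), CFC.rpow_eq_cfc_real hX,
    ← cfc_smul _ _ X (X.continuousOn_spectrum_real _),
    ← cfc_comp_smul c _ X (((Matrix.finite_real_spectrum (A := X)).image _).continuousOn _)]
  refine cfc_congr fun x hx => ?_
  exact Real.mul_rpow hc (spectrum_nonneg_of_nonneg hX hx)

/-- Audenaert's trace inequality, with a general upper bound `D ≥ 0` of `A - B`. -/
lemma Matrix.trace_sub_le_trace_rpow_mul_rpow {A B D : Matrix m m ℂ} (hA : 0 ≤ A) (hB : 0 ≤ B)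
    (hD : 0 ≤ D) (hAB : A ≤ B + D) {s : ℝ} (hs : s ∈ Ioo (0 : ℝ) 1) :
    A.trace.re - D.trace.re ≤ (A ^ s * B ^ (1 - s)).trace.re := by
  have hs' : 1 - s ∈ Ioo (0 : ℝ) 1 := ⟨by linarith [hs.2], by linarith [hs.1]⟩
  have hBC : B ≤ B + D := le_add_of_nonneg_right hD
  have hC : 0 ≤ B + D := add_nonneg hB hD
  have e1 := trace_mul_re_nonneg (CFC.rpow_nonneg (a := A) (y := s))
    (sub_nonneg.mpr (CFC.rpow_le_rpow (Ioo_subset_Icc_self hs') hAB))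
  have e2 := trace_mul_re_nonneg
    (sub_nonneg.mpr (CFC.rpow_le_rpow (Ioo_subset_Icc_self hs) hAB))
    (sub_nonneg.mpr (CFC.rpow_le_rpow (Ioo_subset_Icc_self hs') hBC))
  have e3 := trace_mul_re_nonneg
    (sub_nonneg.mpr (CFC.rpow_le_rpow (Ioo_subset_Icc_self hs) hBC))
    (CFC.rpow_nonneg (a := B) (y := 1 - s))
  simp only [mul_sub, sub_mul, rpow_mul_rpow_one_sub hA hs, rpow_mul_rpow_one_sub hB hs,
    rpow_mul_rpow_one_sub hC hs, trace_sub, trace_add, Complex.sub_re, Complex.add_re]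
    at e1 e2 e3
  linarith

end PowerTraceInequality

section Spectral

open scoped MatrixOrder Matrix.Norms.L2Operator

variable {d n : ℕ}

lemma mpow_eq_rpow {A : Mat d n} (hA : 0 ≤ A) (p : ℝ) : mpow A p = A ^ p := by
  have h : A.IsHermitian := (Matrix.nonneg_iff_posSemidef.mp hA).isHermitian
  rw [CFC.rpow_eq_cfc_real hA, h.cfc_eq, mpow, dif_pos h, Matrix.IsHermitian.cfc,
    Unitary.conjStarAlgAut_apply]
  rfl

lemma posProj_eq_cfc {X : Mat d n} (h : X.IsHermitian) :
    posProj X = cfc (fun x : ℝ => if 0 ≤ x then (1 : ℝ) else 0) X := by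
  rw [h.cfc_eq, posProj, dif_pos h, Matrix.IsHermitian.cfc, Unitary.conjStarAlgAut_apply]
  congr! 3
  ext i
  simp only [Function.comp_apply]
  split_ifs <;> simp

lemma posProj_nonneg {X : Mat d n} (h : X.IsHermitian) : 0 ≤ posProj X := by
  rw [posProj_eq_cfc h]
  exact cfc_nonneg fun x _ => by split_ifs <;> simp

lemma posProj_le_one {X : Mat d n} (h : X.IsHermitian) : posProj X ≤ 1 := by
  rw [posProj_eq_cfc h]
  exact cfc_le_one _ _ fun x _ => by split_ifs <;> simp

lemma mul_posProj_eq_cfc {X : Mat d n} (h : X.IsHermitian) :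
    X * posProj X = cfc (fun x : ℝ => max x 0) X := by
  have h' : IsSelfAdjoint X := h
  rw [posProj_eq_cfc h]
  nth_rw 1 [← cfc_id ℝ X]
  rw [← cfc_mul _ _ X (X.continuousOn_spectrum_real _) (X.continuousOn_spectrum_real _)]
  refine cfc_congr fun x _ => ?_
  by_cases hx : 0 ≤ x
  · simp [hx]
  · simp [hx, (not_le.mp hx).le]

lemma mul_posProj_nonneg {X : Mat d n} (h : X.IsHermitian) : 0 ≤ X * posProj X := by
  rw [mul_posProj_eq_cfc h]
  exact cfc_nonneg fun x _ => le_max_right x 0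

lemma le_mul_posProj {X : Mat d n} (h : X.IsHermitian) : X ≤ X * posProj X := by
  have h' : IsSelfAdjoint X := h
  rw [mul_posProj_eq_cfc h]
  nth_rw 1 [← cfc_id ℝ X]
  exact cfc_mono (fun x _ => le_max_left x 0) (X.continuousOn_spectrum_real _)
    (X.continuousOn_spectrum_real _)

/-- Audenaert's trace inequality for the test that projects onto `{B ≤ A}`. -/
lemma trace_posProj_le_trace_rpow_mul_rpow {A B : Mat d n} (hA : 0 ≤ A) (hB : 0 ≤ B) {s : ℝ}
    (hs : s ∈ Ioo (0 : ℝ) 1) :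
    (A * (1 - posProj (A - B))).trace.re + (B * posProj (A - B)).trace.re ≤
      (A ^ s * B ^ (1 - s)).trace.re := by
  have h : (A - B).IsHermitian :=
    (Matrix.nonneg_iff_posSemidef.mp hA).isHermitian.sub
      (Matrix.nonneg_iff_posSemidef.mp hB).isHermitian
  have key := Matrix.trace_sub_le_trace_rpow_mul_rpow hA hB (mul_posProj_nonneg h)
    (sub_le_iff_le_add'.mp (le_mul_posProj h)) hs
  simp only [sub_mul, mul_sub, mul_one, Matrix.trace_sub, Complex.sub_re] at key ⊢
  linarith

/-- The two error bounds for the test `{c B ≤ A}`. -/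
lemma trace_posProj_sub_smul_le {A B : Mat d n} (hA : A.PosSemidef) (hB : B.PosSemidef) {s c : ℝ}
    (hs : s ∈ Ioo (0 : ℝ) 1) (hc : 0 < c) :
    (A * (1 - posProj (A - c • B))).trace.re ≤
        c ^ (1 - s) * (mpow A s * mpow B (1 - s)).trace.re ∧
      (B * posProj (A - c • B)).trace.re ≤
        c ^ (-s) * (mpow A s * mpow B (1 - s)).trace.re := by
  have hA0 := hA.nonneg
  have hB0 := hB.nonneg
  have hcB : 0 ≤ c • B := smul_nonneg hc.le hB0
  have hX : (A - c • B).IsHermitian :=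
    hA.isHermitian.sub (Matrix.nonneg_iff_posSemidef.mp hcB).isHermitian
  have key := trace_posProj_le_trace_rpow_mul_rpow hA0 hcB hs
  have h1 := Matrix.trace_mul_re_nonneg hA0 (sub_nonneg.mpr (posProj_le_one hX))
  have h2 := Matrix.trace_mul_re_nonneg hB0 (posProj_nonneg hX)
  rw [Matrix.smul_rpow hB0 hc.le, ← mpow_eq_rpow hA0, ← mpow_eq_rpow hB0] at key
  simp only [Matrix.mul_smul, Matrix.smul_mul, Matrix.trace_smul, Complex.smul_re,
    smul_eq_mul] at key
  have hmul : c * c ^ (-s) = c ^ (1 - s) := by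
    rw [sub_eq_add_neg, Real.rpow_add hc, Real.rpow_one]
  constructor
  · linarith [mul_nonneg hc.le h2]
  · refine le_of_mul_le_mul_left ?_ hc
    rw [← mul_assoc, hmul]
    linarith

end Spectral

/-- The Audenaert-type test: with `P` the spectral projection onto the
nonnegative eigenspace of `ρ - 2^{nR} σ`, one has
`tr[ρ(I - P)] ≤ 2^{n(1-α)R} tr[ρ^α σ^{1-α}]` and `tr[σ P] ≤ 2^{-nαR} tr[ρ^α σ^{1-α}]`. -/
theorem audenaert_test_bounds {d : ℕ} (n : ℕ) {α R : ℝ} (hα : α ∈ Set.Ioo (0 : ℝ) 1)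
    (ρ σ : Mat d n) (hρ : IsState ρ) (hσ : IsState σ)
    (P : Mat d n) (hP : P = posProj (ρ - ((2 : ℝ) ^ ((n : ℝ) * R)) • σ)) :
    (ρ * (1 - P)).trace.re ≤
        (2 : ℝ) ^ ((n : ℝ) * (1 - α) * R) * (mpow ρ α * mpow σ (1 - α)).trace.re ∧
      (σ * P).trace.re ≤
        (2 : ℝ) ^ (-((n : ℝ) * α * R)) * (mpow ρ α * mpow σ (1 - α)).trace.re := by
  have h1 : (2 : ℝ) ^ ((n : ℝ) * (1 - α) * R) = ((2 : ℝ) ^ ((n : ℝ) * R)) ^ (1 - α) := by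
    rw [← Real.rpow_mul zero_le_two]
    ring_nf
  have h2 : (2 : ℝ) ^ (-((n : ℝ) * α * R)) = ((2 : ℝ) ^ ((n : ℝ) * R)) ^ (-α) := by
    rw [← Real.rpow_mul zero_le_two]
    ring_nf
  rw [hP, h1, h2]
  exact trace_posProj_sub_smul_le hρ.1 hσ.1 hα (by positivity)

end
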